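/- arXiv:1701.06140 — 2 statements merged into one kernel-verified Lean document; each statement's English description precedes it below -/
import Mathlib

section
/- Let U be a complex Banach space, Ψ = (ψ, s) a finitary evolution in U, F a normed complex vector space and f : U → F a continuous linear map. Then the sampling averages (1/t) ∑_{m=1}^t f(ψ^m s) converge in F as t → ∞ if and only if the sampling values {f(ψ^t s) : t ≥ 1} are bounded in norm. -/
open Filter Finset

namespace SamplingAux

variable {F : Type*} [NormedAddCommGroup F] [NormedSpace ℂ F]

/-- sequences of sublinear growth -/
def subLin (F : Type*) [NormedAddCommGroup F] [NormedSpace ℂ F] : Submodule ℂ (ℕ → F) where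
  carrier := {b | b =o[atTop] (fun t : ℕ => (t : ℝ))}
  add_mem' := fun ha hb => ha.add hb
  zero_mem' := Asymptotics.isLittleO_zero _ _
  smul_mem' := fun c _ hb => hb.const_smul_left c

/-- averages -/
noncomputable def avg (b : ℕ → F) (t : ℕ) : F := (t : ℝ)⁻¹ • ∑ m ∈ Finset.range t, b (m + 1)

/-- bounded sequences with convergent averages -/
def good (F : Type*) [NormedAddCommGroup F] [NormedSpace ℂ F] : Submodule ℂ (ℕ → F) where
  carrier := {b | (∃ C : ℝ, ∀ t, ‖b t‖ ≤ C) ∧ ∃ L, Tendsto (avg b) atTop (nhds L)}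
  add_mem' := by
    rintro a b ⟨⟨C, hC⟩, L, hL⟩ ⟨⟨D, hD⟩, M, hM⟩
    refine ⟨⟨C + D, fun t => (norm_add_le _ _).trans (add_le_add (hC t) (hD t))⟩, L + M, ?_⟩
    refine (hL.add hM).congr fun t => ?_
    simp [avg, Finset.sum_add_distrib]
  zero_mem' := by
    refine ⟨⟨0, by simp⟩, 0, ?_⟩
    refine tendsto_const_nhds.congr fun t => ?_
    simp [avg]
  smul_mem' := by
    rintro c b ⟨⟨C, hC⟩, L, hL⟩
    refine ⟨⟨‖c‖ * C, fun t => ?_⟩, c • L, ?_⟩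
    · simp only [Pi.smul_apply, norm_smul]
      exact mul_le_mul_of_nonneg_left (hC t) (norm_nonneg _)
    · refine (hL.const_smul c).congr fun t => ?_
      simp only [avg, Pi.smul_apply, ← Finset.smul_sum]
      rw [smul_comm]

lemma avg_tendsto {b : ℕ → F} {l : F} (h : Tendsto b atTop (nhds l)) :
    Tendsto (avg b) atTop (nhds l) :=
  ((tendsto_add_atTop_iff_nat 1).2 h).cesaro_smul

lemma good_of_tendsto {b : ℕ → F} {l : F} (h : Tendsto b atTop (nhds l)) : b ∈ good F := by
  refine ⟨?_, l, avg_tendsto h⟩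
  obtain ⟨C, hC⟩ := (Metric.isBounded_range_of_tendsto b h).exists_norm_le
  exact ⟨C, fun t => hC _ ⟨t, rfl⟩⟩

lemma good_geom {l : ℂ} (hl : ‖l‖ = 1) {b : ℕ → F} (h : ∀ t, b t = l ^ t • b 0) :
    b ∈ good F := by
  by_cases h1 : l = 1
  · have : Tendsto b atTop (nhds (b 0)) := by
      refine tendsto_const_nhds.congr fun t => ?_
      rw [h t, h1]; simp
    exact good_of_tendsto this
  refine ⟨⟨‖b 0‖, fun t => by rw [h t, norm_smul, norm_pow, hl]; simp⟩, 0, ?_⟩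
  have hb : ∀ t : ℕ, ‖avg b t‖ ≤ (t : ℝ)⁻¹ * (2 / ‖l - 1‖ * ‖b 0‖) := by
    intro t
    have hs : ∑ m ∈ Finset.range t, b (m + 1) = (l * ((l ^ t - 1) / (l - 1))) • b 0 := by
      rw [← geom_sum_eq h1, Finset.mul_sum, Finset.sum_smul]
      refine Finset.sum_congr rfl fun m _ => ?_
      rw [h (m + 1), pow_succ']
    rw [avg, norm_smul, hs, norm_smul, norm_mul, hl, norm_div, one_mul]
    have h2 : ‖l ^ t - 1‖ ≤ 2 := by
      refine (norm_sub_le _ _).trans ?_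
      rw [norm_pow, hl]; norm_num
    simp only [norm_inv, Real.norm_natCast]
    gcongr
  refine squeeze_zero_norm hb ?_
  have := (tendsto_inv_atTop_nhds_zero_nat (𝕜 := ℝ)).mul_const (2 / ‖l - 1‖ * ‖b 0‖)
  simpa using this

lemma subLin_of_bdd {b : ℕ → F} {C : ℝ} (h : ∀ t, 1 ≤ t → ‖b t‖ ≤ C) : b ∈ subLin F := by
  have h1 : b =O[atTop] (fun _ : ℕ => (1 : ℝ)) := by
    refine Asymptotics.IsBigO.of_bound C ?_
    filter_upwards [eventually_ge_atTop 1] with t ht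
    simpa using h t ht
  refine h1.trans_isLittleO ?_
  rw [Asymptotics.isLittleO_const_left]
  right
  exact tendsto_norm_atTop_atTop.comp tendsto_natCast_atTop_atTop

lemma subLin_shift {b : ℕ → F} (h : b ∈ subLin F) : (fun t => b (t + 1)) ∈ subLin F := by
  have h1 : (fun t => b (t + 1)) =o[atTop] (fun t : ℕ => ((t + 1 : ℕ) : ℝ)) :=
    Asymptotics.IsLittleO.comp_tendsto h (tendsto_add_atTop_nat 1)
  refine h1.trans_isBigO (Asymptotics.IsBigO.of_bound 2 ?_)
  filter_upwards [eventually_ge_atTop 1] with t ht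
  have : (1 : ℝ) ≤ t := by exact_mod_cast ht
  rw [Real.norm_natCast, Real.norm_natCast]
  push_cast; linarith

lemma subLin_of_avg {b : ℕ → F} {L : F} (h : Tendsto (avg b) atTop (nhds L)) : b ∈ subLin F := by
  have h1 : Tendsto (fun t => avg b (t + 1)) atTop (nhds L) := (tendsto_add_atTop_iff_nat 1).2 h
  have h3 : Tendsto (fun t : ℕ => (t : ℝ) / ((t : ℝ) + 1)) atTop (nhds 1) :=
    tendsto_natCast_div_add_atTop (𝕜 := ℝ) 1
  have h4 : Tendsto (fun t : ℕ => ((t + 1 : ℕ) : ℝ)⁻¹ • b (t + 1)) atTop (nhds 0) := by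
    have h5 := h1.sub (h3.smul h)
    rw [one_smul, sub_self] at h5
    refine h5.congr' ?_
    filter_upwards [eventually_ge_atTop 1] with t ht
    have ht' : (t : ℝ) ≠ 0 := by positivity
    have ht2 : (t : ℝ) + 1 ≠ 0 := by positivity
    simp only [avg, Finset.sum_range_succ, smul_smul, smul_add]
    have : (t : ℝ) / (t + 1) * (t : ℝ)⁻¹ = ((t + 1 : ℕ) : ℝ)⁻¹ := by
      push_cast; field_simp
    rw [this]; abel
  have h6 : Tendsto (fun t : ℕ => (t : ℝ)⁻¹ • b t) atTop (nhds 0) :=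
    (tendsto_add_atTop_iff_nat 1).1 h4
  change b =o[atTop] (fun t : ℕ => (t : ℝ))
  rw [← Asymptotics.isLittleO_norm_left, Asymptotics.isLittleO_iff_tendsto']
  · refine (tendsto_zero_iff_norm_tendsto_zero.1 h6).congr fun t => ?_
    rw [norm_smul, norm_inv, Real.norm_natCast, div_eq_inv_mul]
  · filter_upwards [eventually_ge_atTop 1] with t ht h0
    have : (t : ℝ) ≠ 0 := by positivity
    exact absurd h0 this

/-- shift -/
def S (F : Type*) [NormedAddCommGroup F] [NormedSpace ℂ F] : Module.End ℂ (ℕ → F) where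
  toFun b t := b (t + 1)
  map_add' _ _ := rfl
  map_smul' _ _ := rfl

lemma geom_rec {l : ℂ} {b : ℕ → F} (h : ∀ t, b (t + 1) = l • b t) (t : ℕ) :
    b t = l ^ t • b 0 := by
  induction t with
  | zero => simp
  | succ t ih => rw [h, ih, smul_smul, pow_succ']

/-- classification -/
def P (l : ℂ) (b : ℕ → F) : Prop :=
  (1 < ‖l‖ → b = 0) ∧ (‖l‖ = 1 → ∀ t, b t = l ^ t • b 0) ∧
  (‖l‖ < 1 → ∃ r C : ℝ, 0 < r ∧ r < 1 ∧ 0 ≤ C ∧ ∀ t, ‖b t‖ ≤ C * r ^ t)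

lemma P_step {l : ℂ} {b c : ℕ → F} (hb : b ∈ subLin F) (hc : P l c)
    (h : ∀ t, b (t + 1) = l • b t + c t) : P l b := by
  refine ⟨fun hl => ?_, fun hl => ?_, fun hl => ?_⟩
  · have hc0 := hc.1 hl
    have hg := geom_rec (l := l) (b := b) (fun t => by rw [h, hc0]; simp)
    have h1 : (fun t : ℕ => (t : ℝ)) =o[atTop] (fun t : ℕ => ‖l‖ ^ t) := by
      simpa using isLittleO_pow_const_const_pow_of_one_lt (R := ℝ) 1 hl
    have h2 : b =o[atTop] (fun t : ℕ => ‖l‖ ^ t) := Asymptotics.IsLittleO.trans hb h1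
    have h0 : b 0 = 0 := by
      by_contra hne
      have hpos : 0 < ‖b 0‖ := norm_pos_iff.2 hne
      obtain ⟨t, ht⟩ := (h2.def (half_pos hpos)).exists
      rw [hg t, norm_smul, norm_pow, norm_pow, norm_norm] at ht
      have : 0 < ‖l‖ ^ t := by positivity
      nlinarith
    funext t
    rw [hg t, h0]; simp
  · have hcg := hc.2.1 hl
    have hf : ∀ t : ℕ, l • b t = l ^ (t + 1) • b 0 + (t * l ^ t : ℂ) • c 0 := by
      intro t
      induction t with
      | zero => simp
      | succ t ih =>
        rw [h, ih, hcg t]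
        simp only [smul_add, smul_smul, add_assoc, ← add_smul]
        congr 2
        · ring
        · push_cast; ring
    have h0 : c 0 = 0 := by
      by_contra hne
      have hpos : 0 < ‖c 0‖ := norm_pos_iff.2 hne
      have e1 := Asymptotics.IsLittleO.def hb (half_pos hpos)
      have e2 : ∀ᶠ t : ℕ in atTop, 2 * ‖b 0‖ / ‖c 0‖ < (t : ℝ) :=
        tendsto_natCast_atTop_atTop.eventually_gt_atTop _
      obtain ⟨t, ht1, ht2⟩ := (e1.and e2).exists
      have : (t * l ^ t : ℂ) • c 0 = l • b t - l ^ (t + 1) • b 0 := by rw [hf t]; abel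
      have h3 := norm_sub_le (l • b t) (l ^ (t + 1) • b 0)
      rw [← this] at h3
      simp only [norm_smul, norm_mul, norm_pow, hl, one_pow, one_mul, mul_one,
        Complex.norm_natCast] at h3
      rw [Real.norm_natCast] at ht1
      rw [div_lt_iff₀ hpos] at ht2
      nlinarith
    exact geom_rec (fun t => by rw [h, hcg t, h0]; simp)
  · obtain ⟨r, C, hr0, hr1, hC, hcb⟩ := hc.2.2 hl
    obtain ⟨q, hq, hq1⟩ := exists_between (max_lt hr1 hl)
    have hrq : r < q := (le_max_left _ _).trans_lt hq
    have hlq : ‖l‖ < q := (le_max_right _ _).trans_lt hq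
    have hd : 0 < q - ‖l‖ := sub_pos.2 hlq
    have hq0 : 0 < q := hr0.trans hrq
    refine ⟨q, ‖b 0‖ + C / (q - ‖l‖), hq0, hq1, by positivity, fun t => ?_⟩
    set D := ‖b 0‖ + C / (q - ‖l‖) with hD
    have hDC : C ≤ D * (q - ‖l‖) := by
      rw [hD, add_mul, div_mul_cancel₀ _ hd.ne']
      nlinarith [norm_nonneg (b 0), mul_nonneg (norm_nonneg (b 0)) hd.le]
    induction t with
    | zero => simp [hD]; positivity
    | succ t ih =>
      rw [h]
      have h1 : ‖c t‖ ≤ C * q ^ t := (hcb t).trans (by gcongr)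
      calc ‖l • b t + c t‖ ≤ ‖l‖ * ‖b t‖ + ‖c t‖ := by
            rw [← norm_smul]; exact norm_add_le _ _
        _ ≤ ‖l‖ * (D * q ^ t) + C * q ^ t := by gcongr
        _ ≤ ‖l‖ * (D * q ^ t) + (D * (q - ‖l‖)) * q ^ t := by gcongr
        _ = D * q ^ (t + 1) := by ring

lemma P_of_pow (l : ℂ) (k : ℕ) : ∀ b : ℕ → F, b ∈ subLin F →
    ((S F - algebraMap ℂ _ l) ^ k) b = 0 → P l b := by
  induction k with
  | zero =>
    intro b _ h
    have h : b = 0 := by simpa using h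
    subst h
    exact ⟨fun _ => rfl, fun _ t => by simp, fun _ => ⟨1/2, 0, by norm_num, by norm_num, le_rfl,
      fun t => by simp⟩⟩
  | succ k ih =>
    intro b hb h
    rw [pow_succ, Module.End.mul_apply] at h
    have hS : (S F - algebraMap ℂ _ l) b = S F b - l • b := by
      simp [Module.algebraMap_end_apply]
    refine P_step hb (ih _ ?_ h) fun t => ?_
    · rw [hS]
      exact (subLin F).sub_mem (subLin_shift hb) ((subLin F).smul_mem _ hb)
    · rw [hS]
      simp [S]

lemma good_of_P {l : ℂ} {b : ℕ → F} (h : P l b) : b ∈ good F := by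
  rcases lt_trichotomy ‖l‖ 1 with hl | hl | hl
  · obtain ⟨r, C, hr0, hr1, hC, hcb⟩ := h.2.2 hl
    refine good_of_tendsto (l := 0) (squeeze_zero_norm hcb ?_)
    simpa using (tendsto_pow_atTop_nhds_zero_of_lt_one hr0.le hr1).const_mul C
  · exact good_geom hl (h.2.1 hl)
  · rw [h.1 hl]; exact (good F).zero_mem

lemma good_of_invariant (E : Submodule ℂ (ℕ → F)) [FiniteDimensional ℂ E]
    (hE : E ≤ subLin F) (hS : ∀ b ∈ E, S F b ∈ E) : E ≤ good F := by
  let T : Module.End ℂ E := (S F).restrict hS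
  have htop := Module.End.iSup_maxGenEigenspace_eq_top T
  have hle : (⨆ μ : ℂ, T.maxGenEigenspace μ) ≤ (good F).comap E.subtype := by
    refine iSup_le fun μ x hx => ?_
    rw [Module.End.mem_maxGenEigenspace] at hx
    obtain ⟨k, hk⟩ := hx
    refine good_of_P (P_of_pow μ k x.1 (hE x.2) ?_)
    have key : ∀ (k : ℕ) (y : E), (((T - μ • (1 : Module.End ℂ E)) ^ k) y : ℕ → F)
        = ((S F - algebraMap ℂ _ μ) ^ k) y.1 := by
      intro k
      induction k with
      | zero => intro y; simp
      | succ k ih =>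
        intro y
        rw [pow_succ, pow_succ, Module.End.mul_apply, Module.End.mul_apply, ih]
        congr 1
    rw [← key, hk]; rfl
  intro b hb
  have : (⟨b, hb⟩ : E) ∈ (⨆ μ : ℂ, T.maxGenEigenspace μ) := by rw [htop]; trivial
  exact hle this

lemma good_of_subLin {U : Type*} [NormedAddCommGroup U] [NormedSpace ℂ U]
    (φ : U →L[ℂ] U) (v : U)
    (hfin : FiniteDimensional ℂ (Submodule.span ℂ (Set.range fun t : ℕ => (φ ^ t) v)))
    (f : U →L[ℂ] F) (h : (fun t => f ((φ ^ t) v)) ∈ subLin F) :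
    (fun t => f ((φ ^ t) v)) ∈ good F := by
  let Φ : U →ₗ[ℂ] (ℕ → F) := LinearMap.pi fun t => (f ∘L (φ ^ t)).toLinearMap
  have hΦ : ∀ u t, Φ u t = f ((φ ^ t) u) := fun _ _ => rfl
  have hSΦ : ∀ u, S F (Φ u) = Φ (φ u) := by
    intro u; funext t
    change f ((φ ^ (t + 1)) u) = f ((φ ^ t) (φ u))
    rw [pow_succ]; rfl
  let W := Submodule.span ℂ (Set.range fun t : ℕ => (φ ^ t) v)
  have hW : ∀ w ∈ W, φ w ∈ W := by
    intro w hw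
    have : W ≤ W.comap φ.toLinearMap := by
      refine Submodule.span_le.2 ?_
      rintro _ ⟨t, rfl⟩
      refine Submodule.subset_span ⟨t + 1, ?_⟩
      simp only [pow_succ']; rfl
    exact this hw
  have hsub : ∀ k : ℕ, Φ ((φ ^ k) v) ∈ subLin F := by
    intro k
    induction k with
    | zero => exact h
    | succ k ih =>
      have := subLin_shift ih
      have e : Φ ((φ ^ (k + 1)) v) = S F (Φ ((φ ^ k) v)) := by
        rw [hSΦ, pow_succ']; rfl
      rw [e]; exact this
  haveI : FiniteDimensional ℂ W := hfin
  have := good_of_invariant (W.map Φ) ?_ ?_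
  · exact this ⟨v, Submodule.subset_span ⟨0, by simp⟩, rfl⟩
  · rw [Submodule.map_le_iff_le_comap]
    refine Submodule.span_le.2 ?_
    rintro _ ⟨t, rfl⟩
    exact hsub t
  · rintro _ ⟨w, hw, rfl⟩
    exact ⟨φ w, hW w hw, (hSΦ w).symm⟩

end SamplingAux

/-- **Sampling Theorem.** Let `(ψ, s)` be a finitary evolution in a complex
Banach space `U` (i.e. equivalent to some finite-dimensional evolution `(φ, v)`) and let
`f : U → F` be a continuous linear sampling function into a normed space `F`. Then the
sampling averages `(1/t) ∑_{m=1}^t f(ψ^m s)` converge iff the sampling values `f(ψ^t s)`,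
`t ≥ 1`, are bounded in norm. -/
theorem sampling_theorem
    {U : Type*} [NormedAddCommGroup U] [NormedSpace ℂ U] [CompleteSpace U]
    {F : Type*} [NormedAddCommGroup F] [NormedSpace ℂ F]
    (ψ : U →L[ℂ] U) (s : U)
    (hfinitary : ∃ (φ : U →L[ℂ] U) (v : U),
      FiniteDimensional ℂ (Submodule.span ℂ (Set.range fun t : ℕ => (φ ^ t) v)) ∧
      Tendsto (fun t : ℕ => ‖(ψ ^ t) s - (φ ^ t) v‖) atTop (nhds 0))
    (f : U →L[ℂ] F) :
    (∃ L : F, Tendsto (fun t : ℕ => (t : ℝ)⁻¹ • ∑ m ∈ Finset.Icc 1 t, f ((ψ ^ m) s))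
        atTop (nhds L)) ↔
    (∃ C : ℝ, ∀ t : ℕ, 1 ≤ t → ‖f ((ψ ^ t) s)‖ ≤ C) := by
  obtain ⟨φ, v, hfin, hlim⟩ := hfinitary
  have hd : Tendsto (fun t : ℕ => f ((ψ ^ t) s) - f ((φ ^ t) v)) atTop (nhds 0) := by
    have h1 := tendsto_zero_iff_norm_tendsto_zero.2 hlim
    have h2 := (f.continuous.tendsto 0).comp h1
    rw [map_zero] at h2
    exact h2.congr fun t => by simp
  have hdg := SamplingAux.good_of_tendsto hd
  obtain ⟨C, hC⟩ := hdg.1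
  have hdl := SamplingAux.subLin_of_bdd (fun t _ => hC t)
  have main : (fun t : ℕ => f ((ψ ^ t) s)) ∈ SamplingAux.subLin F →
      (fun t : ℕ => f ((ψ ^ t) s)) ∈ SamplingAux.good F := by
    intro h
    have ha := (SamplingAux.subLin F).sub_mem h hdl
    have e1 : (fun t : ℕ => f ((ψ ^ t) s)) - (fun t : ℕ => f ((ψ ^ t) s) - f ((φ ^ t) v))
        = fun t => f ((φ ^ t) v) := by funext t; simp
    rw [e1] at ha
    have hb := (SamplingAux.good F).add_mem (SamplingAux.good_of_subLin φ v hfin f ha) hdg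
    have e2 : (fun t => f ((φ ^ t) v)) + (fun t : ℕ => f ((ψ ^ t) s) - f ((φ ^ t) v))
        = fun t : ℕ => f ((ψ ^ t) s) := by funext t; simp
    rwa [e2] at hb
  have havg : (fun t : ℕ => (t : ℝ)⁻¹ • ∑ m ∈ Finset.Icc 1 t, f ((ψ ^ m) s))
      = SamplingAux.avg (fun t : ℕ => f ((ψ ^ t) s)) := by
    funext t
    rw [SamplingAux.avg, Finset.range_eq_Ico,
      Finset.sum_Ico_add' (fun m : ℕ => f ((ψ ^ m) s)) 0 t 1]
    rfl
  rw [havg]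
  constructor
  · rintro ⟨L, hL⟩
    obtain ⟨D, hD⟩ := (main (SamplingAux.subLin_of_avg hL)).1
    exact ⟨D, fun t _ => hD t⟩
  · rintro ⟨D, hD⟩
    exact (main (SamplingAux.subLin_of_bdd hD)).2
end

section
/- Let U be a complex Banach space and Ψ = (ψ, s) a finitary evolution in U. Then Ψ is mean ergodic if and only if Ψ is stable. -/
open Filter Finset

section helpers

theorem aux_avg_zero {U : Type*} [NormedAddCommGroup U] [NormedSpace ℂ U]
    (u : ℕ → U) (h : Tendsto u atTop (nhds 0)) :
    Tendsto (fun t : ℕ => (t : ℝ)⁻¹ • ∑ m ∈ Finset.Icc 1 t, u m) atTop (nhds 0) := by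
  have h1 := ((tendsto_add_atTop_iff_nat 1).2 h).cesaro_smul
  refine h1.congr fun t => ?_
  congr 1
  rw [Finset.range_eq_Ico, Finset.sum_Ico_add' u 0 t 1]
  rfl

theorem aux_div_zero {U : Type*} [NormedAddCommGroup U] [NormedSpace ℂ U]
    (u : ℕ → U) (x : U)
    (h : Tendsto (fun t : ℕ => (t : ℝ)⁻¹ • ∑ m ∈ Finset.Icc 1 t, u m) atTop (nhds x)) :
    Tendsto (fun t : ℕ => (t : ℝ)⁻¹ • u t) atTop (nhds 0) := by
  rw [← tendsto_add_atTop_iff_nat 1]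
  have h1 := (tendsto_add_atTop_iff_nat 1).2 h
  have h2 := (tendsto_natCast_div_add_atTop (1 : ℝ)).smul h
  have h3 := h1.sub h2
  rw [one_smul, sub_self] at h3
  refine h3.congr' ?_
  filter_upwards [eventually_gt_atTop 0] with t ht
  have ht' : (t : ℝ) ≠ 0 := by positivity
  have e : (t : ℝ) / (t + 1) * (t : ℝ)⁻¹ = ((t + 1 : ℕ) : ℝ)⁻¹ := by
    push_cast; field_simp
  rw [smul_smul, e, ← smul_sub, Finset.sum_Icc_succ_top (by omega)]
  simp

variable {W : Type*} [NormedAddCommGroup W] [NormedSpace ℂ W]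

theorem aux_pow_succ (T : Module.End ℂ W) (n : ℕ) (y : W) : (T ^ (n + 1)) y = (T ^ n) (T y) := by
  rw [pow_succ]; rfl

/-- vectors with bounded orbit -/
def bddSub (T : Module.End ℂ W) : Submodule ℂ W where
  carrier := {y | ∃ c : ℝ, ∀ n : ℕ, ‖(T ^ n) y‖ ≤ c}
  zero_mem' := ⟨0, by simp⟩
  add_mem' := by
    rintro a b ⟨c, hc⟩ ⟨d, hd⟩
    refine ⟨c + d, fun n => ?_⟩
    rw [map_add]
    exact (norm_add_le _ _).trans (add_le_add (hc n) (hd n))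
  smul_mem' := by
    rintro a b ⟨c, hc⟩
    refine ⟨‖a‖ * c, fun n => ?_⟩
    rw [map_smul, norm_smul]
    exact mul_le_mul_of_nonneg_left (hc n) (norm_nonneg _)

/-- vectors with sublinear orbit -/
def subLin (T : Module.End ℂ W) : Submodule ℂ W where
  carrier := {y | Tendsto (fun n : ℕ => (n : ℝ)⁻¹ • (T ^ n) y) atTop (nhds 0)}
  zero_mem' := by simp
  add_mem' := by
    intro a b ha hb
    simpa using Tendsto.add ha hb
  smul_mem' := by
    intro a b hb
    have := Tendsto.const_smul hb a
    rw [smul_zero] at this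
    refine this.congr fun n => ?_
    rw [map_smul, smul_comm]

theorem aux_eig (T : Module.End ℂ W) (μ : ℂ) (y : W) (h : T y = μ • y) (n : ℕ) :
    (T ^ n) y = μ ^ n • y := by
  induction n with
  | zero => simp
  | succ n ih => rw [aux_pow_succ, h, map_smul, ih, smul_smul, pow_succ']

theorem aux_jordan (T : Module.End ℂ W) (μ : ℂ) (y z : W) (h : T y = μ • y + z)
    (hz : T z = μ • z) (n : ℕ) :
    (T ^ (n + 1)) y = μ ^ (n + 1) • y + ((n + 1 : ℂ) * μ ^ n) • z := by
  induction n with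
  | zero => simp [h]
  | succ n ih =>
    rw [aux_pow_succ, h, map_add, map_smul, ih, aux_eig T μ z hz]
    push_cast
    module

theorem aux_gt (T : Module.End ℂ W) (hT : ∀ y, y ∈ subLin T) (μ : ℂ) (hμ : 1 < ‖μ‖) (k : ℕ) :
    ∀ y, ((T - algebraMap ℂ _ μ) ^ k) y = 0 → y = 0 := by
  induction k with
  | zero => simp
  | succ k ih =>
    intro y hy
    rw [aux_pow_succ] at hy
    have h0 := ih _ hy
    have h1 : T y = μ • y := by
      simpa [sub_eq_zero, Module.algebraMap_end_apply] using h0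
    have h2 := (hT y).norm
    rw [norm_zero] at h2
    have h3 : (‖μ‖ - 1) * ‖y‖ ≤ 0 := by
      refine ge_of_tendsto h2 ?_
      filter_upwards [eventually_gt_atTop 0] with n hn
      have hn' : (0 : ℝ) < n := by positivity
      rw [aux_eig T μ y h1, norm_smul, norm_smul, norm_pow, ← mul_assoc, norm_inv, Real.norm_natCast]
      refine mul_le_mul_of_nonneg_right ?_ (norm_nonneg _)
      have hb := one_add_mul_sub_le_pow (show -1 ≤ ‖μ‖ by linarith) n
      rw [inv_mul_eq_div, le_div_iff₀ hn']
      linarith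
    have : ‖y‖ ≤ 0 := by
      by_contra hc
      push Not at hc
      have := mul_pos (sub_pos.2 hμ) hc
      linarith
    exact norm_le_zero_iff.1 this

theorem aux_eq (T : Module.End ℂ W) (hT : ∀ y, y ∈ subLin T) (μ : ℂ) (hμ : ‖μ‖ = 1) (k : ℕ) :
    ∀ y, ((T - algebraMap ℂ _ μ) ^ k) y = 0 → T y = μ • y := by
  induction k with
  | zero =>
    intro y hy
    have : y = 0 := by simpa using hy
    simp [this]
  | succ k ih =>
    intro y hy
    rw [aux_pow_succ] at hy
    have h0 := ih _ hy
    set z := (T - algebraMap ℂ (Module.End ℂ W) μ) y with hz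
    have h1 : T y = μ • y + z := by
      simp [hz, Module.algebraMap_end_apply]
    have h2 := ((tendsto_add_atTop_iff_nat 1).2 (hT y)).norm
    rw [norm_zero] at h2
    have h4 : Tendsto (fun n : ℕ => ((n + 1 : ℕ) : ℝ)⁻¹ * ‖y‖) atTop (nhds 0) := by
      have := ((tendsto_add_atTop_iff_nat 1).2
        (tendsto_inv_atTop_nhds_zero_nat (𝕜 := ℝ))).mul_const ‖y‖
      simpa using this
    have h5 := h2.add h4
    rw [add_zero] at h5
    have h3 : ‖z‖ ≤ 0 := by
      refine ge_of_tendsto h5 (Eventually.of_forall fun n => ?_)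
      have hn' : (0 : ℝ) < (n + 1 : ℕ) := by positivity
      rw [aux_jordan T μ y z h1 h0, norm_smul, norm_inv, Real.norm_natCast, ← mul_add,
        inv_mul_eq_div, le_div_iff₀ hn']
      have e1 : ‖((n + 1 : ℂ) * μ ^ n) • z‖ = ‖z‖ * ((n + 1 : ℕ) : ℝ) := by
        rw [norm_smul, norm_mul, norm_pow, hμ, one_pow, mul_one, mul_comm]
        congr 1
        exact_mod_cast Complex.norm_natCast (n + 1)
      have e2 : ‖μ ^ (n + 1) • y‖ = ‖y‖ := by
        rw [norm_smul, norm_pow, hμ, one_pow, one_mul]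
      rw [← e1, ← e2]
      have := norm_sub_le (μ ^ (n + 1) • y + ((n + 1 : ℂ) * μ ^ n) • z) (μ ^ (n + 1) • y)
      rwa [add_sub_cancel_left] at this
    rw [h1, norm_le_zero_iff.1 h3, add_zero]

theorem aux_lt (T : Module.End ℂ W) (μ : ℂ) (hμ : ‖μ‖ < 1) (k : ℕ) :
    ∀ y, ((T - algebraMap ℂ _ μ) ^ k) y = 0 → y ∈ bddSub T := by
  induction k with
  | zero =>
    intro y hy
    have : y = 0 := by simpa using hy
    rw [this]; exact zero_mem _
  | succ k ih =>
    intro y hy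
    rw [aux_pow_succ] at hy
    obtain ⟨c, hc⟩ := ih _ hy
    set z := (T - algebraMap ℂ (Module.End ℂ W) μ) y with hz
    have h1 : T y = μ • y + z := by
      simp [hz, Module.algebraMap_end_apply]
    have hp : 0 < 1 - ‖μ‖ := by linarith
    refine ⟨max ‖y‖ (c / (1 - ‖μ‖)), fun n => ?_⟩
    induction n with
    | zero => simp
    | succ n ihn =>
      set M := max ‖y‖ (c / (1 - ‖μ‖)) with hM
      have hcM : c ≤ M * (1 - ‖μ‖) := (div_le_iff₀ hp).1 (le_max_right _ _)
      rw [aux_pow_succ, h1, map_add, map_smul]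
      calc _ ≤ ‖μ‖ * ‖(T ^ n) y‖ + ‖(T ^ n) z‖ := by
            rw [← norm_smul]; exact norm_add_le _ _
        _ ≤ ‖μ‖ * M + c := add_le_add (mul_le_mul_of_nonneg_left ihn (norm_nonneg _)) (hc n)
        _ ≤ M := by linarith

theorem aux_bdd [FiniteDimensional ℂ W] (T : Module.End ℂ W) (hT : ∀ y, y ∈ subLin T) (y : W) :
    y ∈ bddSub T := by
  have htop := Module.End.iSup_maxGenEigenspace_eq_top T
  suffices h : (⊤ : Submodule ℂ W) ≤ bddSub T from h Submodule.mem_top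
  rw [← htop]
  refine iSup_le fun μ y hy => ?_
  obtain ⟨k, hk⟩ := Module.End.mem_maxGenEigenspace T μ y |>.1 hy
  rw [← Algebra.algebraMap_eq_smul_one] at hk
  rcases lt_trichotomy ‖μ‖ 1 with h | h | h
  · exact aux_lt T μ h k y hk
  · have := aux_eq T hT μ h k y hk
    refine ⟨‖y‖, fun n => ?_⟩
    rw [aux_eig T μ y this, norm_smul, norm_pow, h, one_pow, one_mul]
  · rw [aux_gt T hT μ h k y hk]; exact zero_mem _

theorem aux_inv_bdd (u : ℕ → W) (c : ℝ) (h : ∀ n, ‖u n‖ ≤ c) :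
    Tendsto (fun n : ℕ => (n : ℝ)⁻¹ • u n) atTop (nhds 0) := by
  have h4 : Tendsto (fun n : ℕ => (n : ℝ)⁻¹ * c) atTop (nhds 0) := by
    simpa using (tendsto_inv_atTop_nhds_zero_nat (𝕜 := ℝ)).mul_const c
  refine squeeze_zero_norm (fun n => ?_) h4
  rw [norm_smul, norm_inv, Real.norm_natCast]
  exact mul_le_mul_of_nonneg_left (h n) (by positivity)

theorem aux_ergodic [FiniteDimensional ℂ W] (T : Module.End ℂ W) (hT : ∀ y, y ∈ bddSub T)
    (v : W) : ∃ x, Tendsto (fun t : ℕ => (t : ℝ)⁻¹ • ∑ m ∈ Finset.Icc 1 t, (T ^ m) v)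
        atTop (nhds x) := by
  have hdis : Disjoint (LinearMap.ker (T - 1)) (LinearMap.range (T - 1)) := by
    rw [Submodule.disjoint_def]
    rintro x hx ⟨y, hy⟩
    have hx' : T x = (1 : ℂ) • x := by simpa [sub_eq_zero] using hx
    have hy' : T y = (1 : ℂ) • y + x := by simp [← hy]
    obtain ⟨c, hc⟩ := hT y
    have h1 := aux_jordan T 1 y x hy' hx'
    have h2 := (aux_inv_bdd _ c hc)
    rw [← tendsto_add_atTop_iff_nat 1] at h2
    have h3 := (tendsto_add_atTop_iff_nat 1).2 (aux_inv_bdd (fun _ => y) ‖y‖ (fun _ => le_rfl))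
    have h4 := h2.sub h3
    rw [sub_zero] at h4
    refine tendsto_nhds_unique (tendsto_const_nhds (x := x)) (h4.congr fun n => ?_)
    rw [← smul_sub, h1 n, one_pow, one_pow, one_smul, mul_one, add_sub_cancel_left]
    have : ((n : ℂ) + 1) • x = ((n + 1 : ℕ) : ℝ) • x := by
      rw [← Complex.coe_smul]; push_cast; rfl
    rw [this, smul_smul, inv_mul_cancel₀ (by positivity), one_smul]
  have htop : LinearMap.ker (T - 1) ⊔ LinearMap.range (T - 1) = ⊤ := by
    apply Submodule.eq_top_of_disjoint _ _ _ hdis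
    rw [add_comm, LinearMap.finrank_range_add_finrank_ker]
  have hv : v ∈ LinearMap.ker (T - 1) ⊔ LinearMap.range (T - 1) := htop ▸ Submodule.mem_top
  obtain ⟨x, hx, _, ⟨y, rfl⟩, rfl⟩ := Submodule.mem_sup.1 hv
  have hx' : T x = (1 : ℂ) • x := by simpa [sub_eq_zero] using hx
  obtain ⟨c, hc⟩ := hT (T y)
  refine ⟨x, ?_⟩
  have h1 := (aux_inv_bdd _ c hc).sub (aux_inv_bdd (fun _ => T y) ‖T y‖ (fun _ => le_rfl))
  have h2 := h1.const_add x
  rw [sub_zero, add_zero] at h2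
  refine h2.congr' ?_
  filter_upwards [eventually_gt_atTop 0] with t ht
  have hs : ∀ t : ℕ, ∑ m ∈ Finset.Icc 1 t, (T ^ m) (x + (T - 1) y)
      = (t : ℝ) • x + ((T ^ t) (T y) - T y) := by
    intro t
    induction t with
    | zero => simp
    | succ t ih =>
      rw [Finset.sum_Icc_succ_top (by omega), ih, map_add, aux_eig T 1 x hx', one_pow, one_smul]
      simp only [LinearMap.sub_apply, map_sub, Module.End.one_apply, aux_pow_succ]
      push_cast
      module
  rw [hs, smul_add, smul_smul, inv_mul_cancel₀ (by positivity), one_smul, smul_sub]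

end helpers

/-- A finitary evolution `(ψ, s)` in a complex Banach space (one that is
equivalent to a finite-dimensional evolution) is mean ergodic if and only if it is stable. -/
theorem finitary_meanErgodic_iff_stable
    {U : Type*} [NormedAddCommGroup U] [NormedSpace ℂ U] [CompleteSpace U]
    (ψ : U →L[ℂ] U) (s : U)
    (hfinitary : ∃ (φ : U →L[ℂ] U) (v : U),
      FiniteDimensional ℂ (Submodule.span ℂ (Set.range fun t : ℕ => (φ ^ t) v)) ∧
      Tendsto (fun t : ℕ => ‖(ψ ^ t) s - (φ ^ t) v‖) atTop (nhds 0)) :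
    (∃ x : U, Tendsto (fun t : ℕ => (t : ℝ)⁻¹ • ∑ m ∈ Finset.Icc 1 t, (ψ ^ m) s)
        atTop (nhds x)) ↔
    (∃ c : ℝ, ∀ t : ℕ, ‖(ψ ^ t) s‖ ≤ c * ‖s‖) := by
  obtain ⟨φ, v, hfd, hlim⟩ := hfinitary
  rw [← tendsto_zero_iff_norm_tendsto_zero] at hlim
  set V := Submodule.span ℂ (Set.range fun t : ℕ => (φ ^ t) v) with hV
  have hmem : ∀ t : ℕ, (φ ^ t) v ∈ V := fun t => Submodule.subset_span ⟨t, rfl⟩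
  have hinv : ∀ x ∈ V, (φ : U →ₗ[ℂ] U) x ∈ V := by
    have : V ≤ V.comap (φ : U →ₗ[ℂ] U) := by
      conv_lhs => rw [hV]
      rw [Submodule.span_le]
      rintro _ ⟨t, rfl⟩
      have := hmem (t + 1)
      rw [pow_succ'] at this
      exact this
    exact this
  let T : Module.End ℂ V := (φ : U →ₗ[ℂ] U).restrict hinv
  have hT : ∀ (n : ℕ) (y : V), (((T ^ n) y : V) : U) = (φ ^ n) (y : U) := by
    intro n
    induction n with
    | zero => intro y; simp
    | succ n ih =>
      intro y
      rw [aux_pow_succ, ih, pow_succ]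
      rfl
  let w : V := ⟨v, by simpa using hmem 0⟩
  -- everything follows from orbit vectors
  have hspan : ∀ P : Submodule ℂ V, (∀ m : ℕ, (T ^ m) w ∈ P) → ∀ y, y ∈ P := by
    intro P hP y
    have : V ≤ P.map V.subtype := by
      conv_lhs => rw [hV]
      rw [Submodule.span_le]
      rintro _ ⟨t, rfl⟩
      exact ⟨(T ^ t) w, hP t, hT t w⟩
    obtain ⟨y', hy', e⟩ := this y.2
    have : y' = y := Subtype.ext e
    exact this ▸ hy'
  have havg := aux_avg_zero _ hlim
  obtain ⟨d, hd⟩ : ∃ d : ℝ, ∀ n : ℕ, ‖(ψ ^ n) s - (φ ^ n) v‖ ≤ d := by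
    obtain ⟨d, hd⟩ := hlim.norm.bddAbove_range
    exact ⟨d, fun n => hd ⟨n, rfl⟩⟩
  constructor
  · rintro ⟨x, hx⟩
    have hx2 : Tendsto (fun t : ℕ => (t : ℝ)⁻¹ • ∑ m ∈ Finset.Icc 1 t, (φ ^ m) v)
        atTop (nhds x) := by
      have := hx.sub havg
      rw [sub_zero] at this
      refine this.congr fun t => ?_
      rw [← smul_sub, ← Finset.sum_sub_distrib]
      simp
    have hdiv := aux_div_zero _ _ hx2
    have hw : w ∈ subLin T := by
      change Tendsto _ _ _
      rw [tendsto_subtype_rng]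
      refine hdiv.congr fun n => ?_
      change _ = (n : ℝ)⁻¹ • (((T ^ n) w : V) : U)
      rw [hT]
    have hsl : ∀ m : ℕ, (T ^ m) w ∈ subLin T := by
      intro m
      have hTc : Continuous (T ^ m : Module.End ℂ V) := LinearMap.continuous_of_finiteDimensional _
      have h1 := (hTc.tendsto 0).comp hw
      rw [map_zero] at h1
      refine h1.congr fun n => ?_
      have := ((T ^ m).restrictScalars ℝ).map_smul ((n : ℝ)⁻¹) ((T ^ n) w)
      refine this.trans ?_
      change (n : ℝ)⁻¹ • ((T ^ m) * (T ^ n)) w = (n : ℝ)⁻¹ • ((T ^ n) * (T ^ m)) w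
      rw [← pow_add, ← pow_add, add_comm]
    obtain ⟨c, hc⟩ := aux_bdd T (hspan _ hsl) w
    by_cases hs : s = 0
    · exact ⟨0, fun t => by simp [hs]⟩
    · refine ⟨(d + c) / ‖s‖, fun t => ?_⟩
      rw [div_mul_cancel₀ _ (norm_ne_zero_iff.2 hs)]
      have h1 := hc t
      rw [Submodule.coe_norm, hT] at h1
      calc ‖(ψ ^ t) s‖ = ‖((ψ ^ t) s - (φ ^ t) v) + (φ ^ t) v‖ := by rw [sub_add_cancel]
        _ ≤ _ := norm_add_le _ _
        _ ≤ _ := add_le_add (hd t) h1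
  · rintro ⟨c, hc⟩
    have hb : ∀ m : ℕ, (T ^ m) w ∈ bddSub T := by
      intro m
      refine ⟨c * ‖s‖ + d, fun n => ?_⟩
      have e : (T ^ n) ((T ^ m) w) = (T ^ (n + m)) w := by rw [pow_add]; rfl
      rw [e, Submodule.coe_norm, hT]
      calc ‖(φ ^ (n + m)) v‖ = ‖(ψ ^ (n + m)) s - ((ψ ^ (n + m)) s - (φ ^ (n + m)) v)‖ := by
            rw [sub_sub_cancel]
        _ ≤ _ := norm_sub_le _ _
        _ ≤ _ := add_le_add (hc _) (hd _)
    obtain ⟨x, hx⟩ := aux_ergodic T (hspan _ hb) w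
    refine ⟨x, ?_⟩
    have h1 := (continuous_subtype_val.tendsto x).comp hx
    have h2 := h1.add havg
    rw [add_zero] at h2
    refine h2.congr fun t => ?_
    have e : (((t : ℝ)⁻¹ • ∑ m ∈ Finset.Icc 1 t, (T ^ m) w : V) : U)
        = (t : ℝ)⁻¹ • ∑ m ∈ Finset.Icc 1 t, (φ ^ m) v := by
      have : ((∑ m ∈ Finset.Icc 1 t, (T ^ m) w : V) : U) = ∑ m ∈ Finset.Icc 1 t, (φ ^ m) v := by
        rw [Submodule.coe_sum]
        exact Finset.sum_congr rfl fun m _ => hT m w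
      rw [← this]; rfl
    simp only [Function.comp]
    rw [e, ← smul_add, ← Finset.sum_add_distrib]
    simp
end
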